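/- arXiv:1604.06637 — 2 statements merged into one kernel-verified Lean document; each statement's English description precedes it below -/
import Mathlib

section
/- Theorem 1(i) (nonnegativity of the γ-divergence for regression): assume the three integrals ∫∫ g(y|x) f(y|x)^γ g(x) dy dx, ∫∫ g(y|x)^{1+γ} g(x) dy dx and ∫∫ f(y|x)^{1+γ} g(x) dy dx are finite and positive. Then D_γ(g(y|x), f(y|x); g(x)) ≥ 0. -/
open MeasureTheory
open scoped ENNReal

/-- The double integral `∫∫ p(y|x) f(y|x)^γ w(x) dy dx` in `ℝ≥0∞`;
`J d γ f f w = ∫∫ f(y|x)^{1+γ} w(x) dy dx`. -/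
noncomputable def J (d : ℕ) (γ : ℝ) (p f : (Fin d → ℝ) → ℝ → ℝ)
    (w : (Fin d → ℝ) → ℝ) : ℝ≥0∞ :=
  ∫⁻ x : Fin d → ℝ,
    (∫⁻ y : ℝ, ENNReal.ofReal (p x y) * ENNReal.ofReal (f x y) ^ γ) *
      ENNReal.ofReal (w x)

/-- The γ-cross entropy for regression with base weight `w`:
`d_γ(p,f;w) = -(1/γ) log ∫∫ p f^γ w + (1/(1+γ)) log ∫∫ f^{1+γ} w`. -/
noncomputable def dgam (d : ℕ) (γ : ℝ) (p f : (Fin d → ℝ) → ℝ → ℝ)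
    (w : (Fin d → ℝ) → ℝ) : ℝ :=
  -(1 / γ) * Real.log (J d γ p f w).toReal +
    (1 / (1 + γ)) * Real.log (J d γ f f w).toReal

/-- The γ-divergence for regression: `D_γ(p,f;w) = d_γ(p,f;w) - d_γ(p,p;w)`. -/
noncomputable def Dgam (d : ℕ) (γ : ℝ) (p f : (Fin d → ℝ) → ℝ → ℝ)
    (w : (Fin d → ℝ) → ℝ) : ℝ :=
  dgam d γ p f w - dgam d γ p p w

/-- `J` as an integral against the product of `w(x) dx` and Lebesgue measure. -/
theorem J_eq_lintegral_prod {d : ℕ} (γ : ℝ) {p f : (Fin d → ℝ) → ℝ → ℝ} {w : (Fin d → ℝ) → ℝ}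
    (hp : Measurable (Function.uncurry p)) (hf : Measurable (Function.uncurry f))
    (hw : Measurable w) :
    J d γ p f w = ∫⁻ z, ENNReal.ofReal (Function.uncurry p z) *
        ENNReal.ofReal (Function.uncurry f z) ^ γ
      ∂((volume.withDensity fun x => ENNReal.ofReal (w x)).prod (volume : Measure ℝ)) := by
  have hm : Measurable fun z => ENNReal.ofReal (Function.uncurry p z) *
      ENNReal.ofReal (Function.uncurry f z) ^ γ :=
    hp.ennreal_ofReal.mul (hf.ennreal_ofReal.pow_const γ)
  rw [lintegral_prod _ hm.aemeasurable,
    lintegral_withDensity_eq_lintegral_mul _ hw.ennreal_ofReal hm.lintegral_prod_right', J]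
  exact lintegral_congr fun x => mul_comm _ _

/-- Hölder's inequality with exponents `1 + γ` and `(1 + γ) / γ` for the double integral `J`. -/
theorem J_le_rpow_mul_rpow {d : ℕ} {γ : ℝ} (hγ : 0 < γ) {p f : (Fin d → ℝ) → ℝ → ℝ}
    {w : (Fin d → ℝ) → ℝ} (hp : Measurable (Function.uncurry p))
    (hf : Measurable (Function.uncurry f)) (hw : Measurable w) :
    J d γ p f w ≤ J d γ p p w ^ (1 / (1 + γ)) * J d γ f f w ^ (γ / (1 + γ)) := by
  have hmul (a : ℝ≥0∞) : a * a ^ γ = a ^ (1 + γ) := by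
    rw [ENNReal.rpow_add_of_nonneg _ _ zero_le_one hγ.le, ENNReal.rpow_one]
  have hpow (a : ℝ≥0∞) : a * a ^ γ = (a ^ γ) ^ ((1 + γ) / γ) := by
    rw [hmul, ← ENNReal.rpow_mul, mul_div_cancel₀ _ hγ.ne']
  have hpq : (1 + γ).HolderConjugate ((1 + γ) / γ) := by
    rw [Real.holderConjugate_iff]
    refine ⟨by linarith, ?_⟩
    field_simp
  rw [J_eq_lintegral_prod γ hp hf hw, J_eq_lintegral_prod γ hp hp hw,
    J_eq_lintegral_prod γ hf hf hw]
  simp_rw [hmul (ENNReal.ofReal (Function.uncurry p _)),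
    hpow (ENNReal.ofReal (Function.uncurry f _))]
  rw [← one_div_div (1 + γ) γ]
  exact ENNReal.lintegral_mul_le_Lp_mul_Lq _ hpq hp.ennreal_ofReal.aemeasurable
    (hf.ennreal_ofReal.pow_const γ).aemeasurable

/-- Theorem 1(i): nonnegativity of the γ-divergence for regression. -/
theorem gamma_divergence_nonneg {d : ℕ} {γ : ℝ} (hγ : 0 < γ)
    (g f : (Fin d → ℝ) → ℝ → ℝ) (gx : (Fin d → ℝ) → ℝ)
    (hg_meas : Measurable (Function.uncurry g))
    (hf_meas : Measurable (Function.uncurry f))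
    (hgx_meas : Measurable gx)
    (hg_nonneg : ∀ x y, 0 ≤ g x y) (hf_nonneg : ∀ x y, 0 ≤ f x y)
    (hgx_nonneg : ∀ x, 0 ≤ gx x)
    (hg_dens : ∀ᵐ x : Fin d → ℝ ∂volume, ∫ y : ℝ, g x y = 1)
    (hf_dens : ∀ᵐ x : Fin d → ℝ ∂volume, ∫ y : ℝ, f x y = 1)
    (hgx_int : Integrable gx) (hgx_prob : ∫ x : Fin d → ℝ, gx x = 1)
    (hgf_pos : 0 < J d γ g f gx) (hgf_fin : J d γ g f gx ≠ ⊤)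
    (hgg_pos : 0 < J d γ g g gx) (hgg_fin : J d γ g g gx ≠ ⊤)
    (hff_pos : 0 < J d γ f f gx) (hff_fin : J d γ f f gx ≠ ⊤) :
    0 ≤ Dgam d γ g f gx := by
  have hG := ENNReal.toReal_pos hgg_pos.ne' hgg_fin
  have hF := ENNReal.toReal_pos hff_pos.ne' hff_fin
  have hle := ENNReal.toReal_mono
    (ENNReal.mul_ne_top (ENNReal.rpow_ne_top_of_nonneg (by positivity) hgg_fin)
      (ENNReal.rpow_ne_top_of_nonneg (by positivity) hff_fin))
    (J_le_rpow_mul_rpow hγ hg_meas hf_meas hgx_meas)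
  rw [ENNReal.toReal_mul, ← ENNReal.toReal_rpow, ← ENNReal.toReal_rpow] at hle
  have hlog := Real.log_le_log (ENNReal.toReal_pos hgf_pos.ne' hgf_fin) hle
  rw [Real.log_mul (Real.rpow_pos_of_pos hG _).ne' (Real.rpow_pos_of_pos hF _).ne',
    Real.log_rpow hG, Real.log_rpow hF] at hlog
  have key : Dgam d γ g f gx = (1 / γ) * (1 / (1 + γ) * Real.log (J d γ g g gx).toReal +
      γ / (1 + γ) * Real.log (J d γ f f gx).toReal - Real.log (J d γ g f gx).toReal) := by
    unfold Dgam dgam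
    field_simp
    ring
  rw [key]
  exact mul_nonneg (by positivity) (sub_nonneg.mpr hlog)
end

section
/- Exact form of Theorem 3 (heterogeneous contamination): under heterogeneous contamination g(y|x) = (1−ε(x)) f*(y|x) + ε(x) δ(y|x) with ε: ℝ^d→[0,1) measurable and c := 1 − ∫ ε(x) g(x) dx > 0, and with f(y|x) = (1/σ) s((y−q(x))/σ) a location-scale conditional density with ∫ s^{1+γ} ∈ (0,∞), assume A := ∫∫ f*(y|x) f(y|x)^γ (1−ε(x)) g(x) dy dx ∈ (0,∞) and T := ∫ ν_{f,γ}(x)^γ ε(x) g(x) dx < ∞. Then d_γ(g(y|x), f(y|x); g(x)) = d_γ(f*(y|x), f(y|x); (1−ε(x))g(x)) − (1/(1+γ)) log c − (1/γ) log(1 + T/A), where d_γ with base measure (1−ε(x))g(x) is defined by replacing g(x)dx with (1−ε(x))g(x)dx in both integrals of the γ-cross entropy. -/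
open MeasureTheory
open scoped ENNReal

lemma J_const_of_inner_const {d : ℕ} {γ : ℝ} {p f : (Fin d → ℝ) → ℝ → ℝ}
    {w : (Fin d → ℝ) → ℝ} {K : ℝ} (hK : 0 ≤ K)
    (h : ∀ x, ∫⁻ y : ℝ, ENNReal.ofReal (p x y) * ENNReal.ofReal (f x y) ^ γ =
      ENNReal.ofReal K)
    (hw : Integrable w) (hw_nonneg : ∀ x, 0 ≤ w x) :
    (J d γ p f w).toReal = K * ∫ x, w x := by
  unfold J
  simp_rw [h]
  rw [lintegral_const_mul' _ _ ENNReal.ofReal_ne_top,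
    ← ofReal_integral_eq_lintegral_ofReal hw (.of_forall hw_nonneg), ENNReal.toReal_mul,
    ENNReal.toReal_ofReal hK, ENNReal.toReal_ofReal (integral_nonneg hw_nonneg)]

lemma lintegral_location_scale_rpow {γ : ℝ} (hγ : 0 < γ) {s : ℝ → ℝ}
    (hs_nonneg : ∀ z, 0 ≤ s z) (hs_pow_int : Integrable fun z : ℝ => s z ^ (1 + γ))
    {σ : ℝ} (hσ : 0 < σ) (m : ℝ) :
    ∫⁻ y : ℝ, ENNReal.ofReal ((1 / σ) * s ((y - m) / σ)) *
        ENNReal.ofReal ((1 / σ) * s ((y - m) / σ)) ^ γ =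
      ENNReal.ofReal ((1 / σ) ^ (1 + γ) * (σ * ∫ z : ℝ, s z ^ (1 + γ))) := by
  have hint : Integrable fun y : ℝ => (1 / σ) ^ (1 + γ) * s ((y - m) / σ) ^ (1 + γ) :=
    ((hs_pow_int.comp_div hσ.ne').comp_sub_right m).const_mul _
  have hval : ∫ y : ℝ, (1 / σ) ^ (1 + γ) * s ((y - m) / σ) ^ (1 + γ) =
      (1 / σ) ^ (1 + γ) * (σ * ∫ z : ℝ, s z ^ (1 + γ)) := by
    rw [integral_const_mul, integral_sub_right_eq_self (fun y => s (y / σ) ^ (1 + γ)) m,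
      Measure.integral_comp_div (fun z => s z ^ (1 + γ)) σ, abs_of_pos hσ, smul_eq_mul]
  rw [← hval, ofReal_integral_eq_lintegral_ofReal hint (.of_forall fun y =>
    mul_nonneg (by positivity) (Real.rpow_nonneg (hs_nonneg _) _))]
  refine lintegral_congr fun y => ?_
  have h0 : 0 ≤ 1 / σ * s ((y - m) / σ) := mul_nonneg (by positivity) (hs_nonneg _)
  rw [ENNReal.ofReal_rpow_of_nonneg h0 hγ.le, ← ENNReal.ofReal_mul h0,
    ← Real.mul_rpow (by positivity) (hs_nonneg _),
    Real.rpow_add_of_nonneg h0 zero_le_one hγ.le, Real.rpow_one]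

lemma J_mixture {d : ℕ} {γ : ℝ} {p₀ p₁ p f : (Fin d → ℝ) → ℝ → ℝ}
    {ε w : (Fin d → ℝ) → ℝ} (hε : Measurable ε) (hw : Measurable w)
    (hε_nonneg : ∀ x, 0 ≤ ε x) (hε_le : ∀ x, ε x ≤ 1)
    (hp₀ : Measurable (Function.uncurry p₀)) (hp₁ : Measurable (Function.uncurry p₁))
    (hf : Measurable (Function.uncurry f))
    (hp₀_nonneg : ∀ x y, 0 ≤ p₀ x y) (hp₁_nonneg : ∀ x y, 0 ≤ p₁ x y)
    (hp : ∀ x y, p x y = (1 - ε x) * p₀ x y + ε x * p₁ x y) :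
    J d γ p f w =
      J d γ p₀ f (fun x => (1 - ε x) * w x) + J d γ p₁ f (fun x => ε x * w x) := by
  have hm : ∀ {r : (Fin d → ℝ) → ℝ → ℝ}, Measurable (Function.uncurry r) →
      Measurable (fun z : (Fin d → ℝ) × ℝ =>
        ENNReal.ofReal (r z.1 z.2) * ENNReal.ofReal (f z.1 z.2) ^ γ) := fun hr =>
    (ENNReal.measurable_ofReal.comp hr).mul
      ((ENNReal.measurable_ofReal.comp hf).pow_const γ)
  have hm₀ := hm hp₀
  have hm₁ := hm hp₁
  have hinner : Measurable fun x => ∫⁻ y : ℝ,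
      ENNReal.ofReal (p₀ x y) * ENNReal.ofReal (f x y) ^ γ := hm₀.lintegral_prod_right'
  have houter : Measurable fun x => (∫⁻ y : ℝ,
      ENNReal.ofReal (p₀ x y) * ENNReal.ofReal (f x y) ^ γ) *
        ENNReal.ofReal ((1 - ε x) * w x) := hinner.mul (by fun_prop)
  unfold J
  rw [← lintegral_add_left houter]
  refine lintegral_congr fun x => ?_
  have hε' : 0 ≤ 1 - ε x := sub_nonneg.2 (hε_le x)
  have hx₀ : Measurable fun y => ENNReal.ofReal (p₀ x y) * ENNReal.ofReal (f x y) ^ γ :=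
    hm₀.comp measurable_prodMk_left
  have hx₁ : Measurable fun y => ENNReal.ofReal (p₁ x y) * ENNReal.ofReal (f x y) ^ γ :=
    hm₁.comp measurable_prodMk_left
  have key : ∀ y, ENNReal.ofReal (p x y) * ENNReal.ofReal (f x y) ^ γ =
      ENNReal.ofReal (1 - ε x) * (ENNReal.ofReal (p₀ x y) * ENNReal.ofReal (f x y) ^ γ) +
      ENNReal.ofReal (ε x) * (ENNReal.ofReal (p₁ x y) * ENNReal.ofReal (f x y) ^ γ) := by
    intro y
    rw [hp, ENNReal.ofReal_add (mul_nonneg hε' (hp₀_nonneg x y))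
      (mul_nonneg (hε_nonneg x) (hp₁_nonneg x y)), ENNReal.ofReal_mul hε',
      ENNReal.ofReal_mul (hε_nonneg x)]
    ring
  simp_rw [key]
  rw [lintegral_add_left (hx₀.const_mul _), lintegral_const_mul _ hx₀,
    lintegral_const_mul _ hx₁, ENNReal.ofReal_mul hε', ENNReal.ofReal_mul (hε_nonneg x)]
  ring

/-- Exact form of Theorem 3 (heterogeneous contamination):
`d_γ(g,f;g(x)) = d_γ(f*,f;(1−ε(x))g(x)) − (1/(1+γ)) log c − (1/γ) log(1 + T/A)`
with `c = 1 − ∫ε(x)g(x)dx`, `A = ∫∫ f* f^γ (1−ε(x))g(x)`,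
`T = ∫ ν_{f,γ}(x)^γ ε(x) g(x) dx`. -/
theorem gamma_cross_entropy_heterogeneous_exact {d : ℕ} {γ : ℝ} (hγ : 0 < γ)
    (fstar δ g : (Fin d → ℝ) → ℝ → ℝ) (gx : (Fin d → ℝ) → ℝ)
    (ε : (Fin d → ℝ) → ℝ) (hε_meas : Measurable ε)
    (hε_nonneg : ∀ x, 0 ≤ ε x) (hε_lt : ∀ x, ε x < 1)
    (hfstar_meas : Measurable (Function.uncurry fstar))
    (hδ_meas : Measurable (Function.uncurry δ))
    (hgx_meas : Measurable gx)
    (hfstar_nonneg : ∀ x y, 0 ≤ fstar x y) (hδ_nonneg : ∀ x y, 0 ≤ δ x y)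
    (hgx_nonneg : ∀ x, 0 ≤ gx x)
    (hfstar_dens : ∀ᵐ x : Fin d → ℝ ∂volume, ∫ y : ℝ, fstar x y = 1)
    (hδ_dens : ∀ᵐ x : Fin d → ℝ ∂volume, ∫ y : ℝ, δ x y = 1)
    (hgx_int : Integrable gx) (hgx_prob : ∫ x : Fin d → ℝ, gx x = 1)
    -- the location-scale parametric family f(y|x) = (1/σ) s((y − q(x))/σ)
    (s : ℝ → ℝ) (hs_meas : Measurable s) (hs_nonneg : ∀ z, 0 ≤ s z)
    (hs_prob : ∫ z : ℝ, s z = 1)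
    (hs_pow_int : Integrable fun z : ℝ => s z ^ (1 + γ))
    (hs_pow_pos : 0 < ∫ z : ℝ, s z ^ (1 + γ))
    (σ : ℝ) (hσ : 0 < σ) (q : (Fin d → ℝ) → ℝ) (hq : Measurable q)
    (f : (Fin d → ℝ) → ℝ → ℝ)
    (hf : ∀ x y, f x y = (1 / σ) * s ((y - q x) / σ))
    -- heterogeneous contamination
    (hg : ∀ x y, g x y = (1 - ε x) * fstar x y + ε x * δ x y)
    -- finiteness and positivity assumptions
    (hc_pos : 0 < 1 - ∫ x : Fin d → ℝ, ε x * gx x)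
    (hA_pos : 0 < J d γ fstar f (fun x => (1 - ε x) * gx x))
    (hA_fin : J d γ fstar f (fun x => (1 - ε x) * gx x) ≠ ⊤)
    (hT_fin : J d γ δ f (fun x => ε x * gx x) ≠ ⊤) :
    dgam d γ g f gx =
      dgam d γ fstar f (fun x => (1 - ε x) * gx x) -
        (1 / (1 + γ)) * Real.log (1 - ∫ x : Fin d → ℝ, ε x * gx x) -
        (1 / γ) * Real.log
          (1 + (J d γ δ f (fun x => ε x * gx x)).toReal /
            (J d γ fstar f (fun x => (1 - ε x) * gx x)).toReal) := by
  have hf_meas : Measurable (Function.uncurry f) := by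
    have : Function.uncurry f =
        fun z : (Fin d → ℝ) × ℝ => (1 / σ) * s ((z.2 - q z.1) / σ) := by
      ext z; exact hf z.1 z.2
    rw [this]
    fun_prop
  have hmix := J_mixture (γ := γ) hε_meas hgx_meas hε_nonneg (fun x => (hε_lt x).le)
    hfstar_meas hδ_meas hf_meas hfstar_nonneg hδ_nonneg hg
  set K : ℝ := (1 / σ) ^ (1 + γ) * (σ * ∫ z : ℝ, s z ^ (1 + γ)) with hK_def
  have hK : 0 < K := by positivity
  have hinner : ∀ x, ∫⁻ y : ℝ, ENNReal.ofReal (f x y) * ENNReal.ofReal (f x y) ^ γ =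
      ENNReal.ofReal K := by
    intro x
    simp_rw [hf]
    exact lintegral_location_scale_rpow hγ hs_nonneg hs_pow_int hσ (q x)
  have hεg_int : Integrable fun x => ε x * gx x :=
    hgx_int.bdd_mul hε_meas.aestronglyMeasurable (c := 1) (.of_forall fun x => by
      rw [Real.norm_of_nonneg (hε_nonneg x)]; exact (hε_lt x).le)
  have hw_eq : (fun x => (1 - ε x) * gx x) = fun x => gx x - ε x * gx x := by
    ext x; ring
  have hw_int : Integrable fun x => (1 - ε x) * gx x := by
    rw [hw_eq]; exact hgx_int.sub hεg_int
  have hw_val : ∫ x, (1 - ε x) * gx x = 1 - ∫ x, ε x * gx x := by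
    rw [hw_eq, integral_sub hgx_int hεg_int, hgx_prob]
  have hJ₁ := J_const_of_inner_const hK.le hinner hgx_int hgx_nonneg
  have hJ₂ := J_const_of_inner_const hK.le hinner hw_int fun x =>
    mul_nonneg (sub_nonneg.2 (hε_lt x).le) (hgx_nonneg x)
  rw [hgx_prob, mul_one] at hJ₁
  rw [hw_val] at hJ₂
  unfold dgam
  rw [hmix, ENNReal.toReal_add hA_fin hT_fin, hJ₁, hJ₂, Real.log_mul hK.ne' hc_pos.ne']
  set A := (J d γ fstar f (fun x => (1 - ε x) * gx x)).toReal
  set T := (J d γ δ f (fun x => ε x * gx x)).toReal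
  have hA : 0 < A := ENNReal.toReal_pos hA_pos.ne' hA_fin
  have hT : 0 ≤ T := ENNReal.toReal_nonneg
  have hlog : Real.log (A + T) = Real.log A + Real.log (1 + T / A) := by
    rw [← Real.log_mul hA.ne' (by positivity)]
    congr 1
    field_simp
  rw [hlog]
  ring
end
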